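/- Let P be a generic convex polygon with n ≥ 5 vertices, let N be the number of locally extremal vertices of P, and let E(P) be its evolute. Then wind(E(P)) = (2 − N)/2; consequently wind(E(P)) < 0 if and only if P has at least four locally extremal vertices. -/

import Mathlib

open EuclideanGeometry
open scoped Classical

noncomputable section

/-- The Euclidean plane. -/
abbrev Pt := EuclideanSpace ℝ (Fin 2)

/-- Signed area determinant of the triangle `a b c` (positive iff `a b c` is
counterclockwise, i.e. `c` lies strictly to the left of the directed line `a → b`). -/
def det2 (a b c : Pt) : ℝ :=
  (b 0 - a 0) * (c 1 - a 1) - (b 1 - a 1) * (c 0 - a 0)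

/-- The vertices `V 0, V 1, …, V (n-1)` (indices mod `n`) are distinct and in convex
position, listed counterclockwise: every other vertex lies strictly to the left of
each directed edge. -/
def ConvexCCW {n : ℕ} (V : ZMod n → Pt) : Prop :=
  Function.Injective V ∧
    ∀ i j : ZMod n, j ≠ i → j ≠ i + 1 → 0 < det2 (V i) (V (i + 1)) (V j)

/-- The polygon is generic: no three vertices are collinear and no four vertices lie
on a common circle. -/
def GenericPoly {n : ℕ} (V : ZMod n → Pt) : Prop :=
  (∀ i j k : ZMod n, i ≠ j → j ≠ k → i ≠ k →
      ¬ Collinear ℝ ({V i, V j, V k} : Set Pt)) ∧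
  (∀ i j k l : ZMod n, i ≠ j → i ≠ k → i ≠ l → j ≠ k → j ≠ l → k ≠ l →
      ¬ ∃ (O : Pt) (R : ℝ),
        dist (V i) O = R ∧ dist (V j) O = R ∧ dist (V k) O = R ∧ dist (V l) O = R)

/-- `O i` is the center and `R i` the radius of the circle `C i` through
`V (i-1)`, `V i`, `V (i+1)`. -/
def IsCircumData {n : ℕ} (V O : ZMod n → Pt) (R : ZMod n → ℝ) : Prop :=
  ∀ i : ZMod n,
    dist (V (i - 1)) (O i) = R i ∧ dist (V i) (O i) = R i ∧
      dist (V (i + 1)) (O i) = R i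

/-- The polygon is coherent: each circumcenter `O i` lies in the closed infinite cone
with apex `V i` spanned by the rays from `V i` through `V (i-1)` and `V (i+1)`. -/
def Coherent {n : ℕ} (V O : ZMod n → Pt) : Prop :=
  ∀ i : ZMod n, ∃ s t : ℝ, 0 ≤ s ∧ 0 ≤ t ∧
    O i - V i = s • (V (i - 1) - V i) + t • (V (i + 1) - V i)

/-- `V i` is locally maximal-extremal: `V (i-2)` and `V (i+2)` lie strictly outside `C i`. -/
def LocMax {n : ℕ} (V O : ZMod n → Pt) (R : ZMod n → ℝ) (i : ZMod n) : Prop :=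
  R i < dist (V (i - 2)) (O i) ∧ R i < dist (V (i + 2)) (O i)

/-- `V i` is locally minimal-extremal: `V (i-2)` and `V (i+2)` lie strictly inside `C i`. -/
def LocMin {n : ℕ} (V O : ZMod n → Pt) (R : ZMod n → ℝ) (i : ZMod n) : Prop :=
  dist (V (i - 2)) (O i) < R i ∧ dist (V (i + 2)) (O i) < R i

/-- `V i` is globally maximal-extremal: the open disk bounded by `C i` contains no vertex. -/
def GlobMax {n : ℕ} (V O : ZMod n → Pt) (R : ZMod n → ℝ) (i : ZMod n) : Prop :=
  ∀ j : ZMod n, R i ≤ dist (V j) (O i)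

/-- `V i` is globally minimal-extremal: the open disk bounded by `C i` contains every
vertex other than `V (i-1)`, `V i`, `V (i+1)`. -/
def GlobMin {n : ℕ} (V O : ZMod n → Pt) (R : ZMod n → ℝ) (i : ZMod n) : Prop :=
  ∀ j : ZMod n, j ≠ i - 1 → j ≠ i → j ≠ i + 1 → dist (V j) (O i) < R i

/-- `V i` is radially maximal-extremal: `R (i-1) < R i > R (i+1)`. -/
def RadMax {n : ℕ} (R : ZMod n → ℝ) (i : ZMod n) : Prop :=
  R (i - 1) < R i ∧ R (i + 1) < R i

/-- `V i` is radially minimal-extremal: `R (i-1) > R i < R (i+1)`. -/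
def RadMin {n : ℕ} (R : ZMod n → ℝ) (i : ZMod n) : Prop :=
  R i < R (i - 1) ∧ R i < R (i + 1)

end

noncomputable section

/-- The angle of a closed polygon at the middle vertex `b` (coming from `a`, leaving
towards `c`), measured on the left-hand side with respect to the direction of
traversal; it equals the unsigned angle `∠ a b c` when the traversal turns left at `b`
and `2π - ∠ a b c` when it turns right. -/
def leftAngle (a b c : Pt) : ℝ :=
  if 0 < det2 a b c then EuclideanGeometry.angle a b c
  else 2 * Real.pi - EuclideanGeometry.angle a b c

/-- The discrete winding number of the closed polygon with vertex sequence `W`: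
`wind(W) = (1/2π) ∑ᵢ (π - ∠Wᵢ)`. -/
def wind {n : ℕ} [NeZero n] (W : ZMod n → Pt) : ℝ :=
  (1 / (2 * Real.pi)) *
    ∑ i : ZMod n, (Real.pi - leftAngle (W (i - 1)) (W i) (W (i + 1)))

end

theorem dist_sq_coord (x y : Pt) : dist x y ^ 2 = (x 0 - y 0) ^ 2 + (x 1 - y 1) ^ 2 := by
  rw [EuclideanSpace.dist_eq, Real.sq_sqrt (by positivity), Fin.sum_univ_two, Real.dist_eq,
    Real.dist_eq, sq_abs, sq_abs]

/-- Rotation by a right angle counterclockwise. -/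
noncomputable def rotQ (u : Pt) : Pt := !₂[-u 1, u 0]

theorem inner_coord (u v : Pt) : inner ℝ u v = u 0 * v 0 + u 1 * v 1 := by
  simp [PiLp.inner_apply, Fin.sum_univ_two, mul_comm]

theorem norm_coord (u : Pt) : ‖u‖ = Real.sqrt (u 0 ^ 2 + u 1 ^ 2) := by
  simp [EuclideanSpace.norm_eq, Fin.sum_univ_two]

theorem angle_rotQ (u v : Pt) :
    InnerProductGeometry.angle (rotQ u) (rotQ v) = InnerProductGeometry.angle u v := by
  unfold InnerProductGeometry.angle
  rw [inner_coord, inner_coord, norm_coord, norm_coord, norm_coord u, norm_coord v]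
  simp only [rotQ, PiLp.toLp_apply, Matrix.cons_val_zero, Matrix.cons_val_one, neg_sq]
  congr 2
  · ring
  · rw [add_comm (u 1 ^ 2), add_comm (v 1 ^ 2)]

theorem angle_add_of_det {p a b c : Pt} (h1 : 0 < det2 p a b) (h2 : 0 < det2 p b c)
    (h3 : 0 < det2 p a c) :
    EuclideanGeometry.angle a p c = EuclideanGeometry.angle a p b + EuclideanGeometry.angle b p c := by
  unfold EuclideanGeometry.angle
  have hb : b -ᵥ p ≠ 0 := by
    intro h
    have h' : b = p := by simpa [sub_eq_zero] using h
    rw [h'] at h1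
    unfold det2 at h1
    simp at h1
  apply InnerProductGeometry.angle_eq_angle_add_add_angle_add_of_mem_span hb
  rw [Submodule.mem_span_pair]
  have h3' := h3.ne'
  refine ⟨⟨det2 p b c / det2 p a c, by positivity⟩, ⟨det2 p a b / det2 p a c, by positivity⟩, ?_⟩
  change (det2 p b c / det2 p a c) • (a -ᵥ p) + (det2 p a b / det2 p a c) • (c -ᵥ p) = b -ᵥ p
  ext i
  fin_cases i <;>
  · simp
    field_simp
    unfold det2
    ring

theorem exists_lam {a b p q : Pt} (hab : a ≠ b) (hp : dist a p = dist b p)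
    (hq : dist a q = dist b q) :
    ∃ l : ℝ, q - p = l • rotQ (b - a) := by
  have hp2 := congrArg (· ^ 2) hp
  have hq2 := congrArg (· ^ 2) hq
  simp only [dist_sq_coord] at hp2 hq2
  have hD : 0 < (b 0 - a 0) ^ 2 + (b 1 - a 1) ^ 2 := by
    rw [← dist_sq_coord]
    have := dist_pos.2 hab.symm
    positivity
  have hD' := hD.ne'
  have hE : (b 0 - a 0) * (q 0 - p 0) + (b 1 - a 1) * (q 1 - p 1) = 0 := by
    linear_combination (hq2 - hp2) / 2
  refine ⟨((b 0 - a 0) * (q 1 - p 1) - (b 1 - a 1) * (q 0 - p 0)) /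
    ((b 0 - a 0) ^ 2 + (b 1 - a 1) ^ 2), ?_⟩
  ext i
  fin_cases i
  · simp [rotQ]
    field_simp
    linear_combination (b 0 - a 0) * hE
  · simp [rotQ]
    field_simp
    linear_combination (b 1 - a 1) * hE

theorem rotQ_coords {a b p q : Pt} {l : ℝ} (h : q - p = l • rotQ (b - a)) :
    q 0 = p 0 - l * (b 1 - a 1) ∧ q 1 = p 1 + l * (b 0 - a 0) := by
  have h0 := congrArg (fun v : Pt => v 0) h
  have h1 := congrArg (fun v : Pt => v 1) h
  simp [rotQ] at h0 h1
  constructor <;> linarith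

theorem power_diff {a b p q : Pt} {l : ℝ} (h : q - p = l • rotQ (b - a)) (x : Pt) :
    dist x p ^ 2 - dist a p ^ 2 - (dist x q ^ 2 - dist a q ^ 2) = 2 * l * det2 a b x := by
  obtain ⟨h0, h1⟩ := rotQ_coords h
  simp only [dist_sq_coord, det2, h0, h1]
  ring

theorem turn {a b c p q r : Pt} {l m : ℝ} (h : q - p = l • rotQ (b - a))
    (h' : r - q = m • rotQ (c - b)) (hl : l ≠ 0) (hm : m ≠ 0) (hd : 0 < det2 a b c) :
    leftAngle p q r = EuclideanGeometry.angle a b c + if l * m < 0 then Real.pi else 0 := by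
  have hdet : det2 p q r = (l * m) * det2 a b c := by
    obtain ⟨h0, h1⟩ := rotQ_coords h
    obtain ⟨h2, h3⟩ := rotQ_coords h'
    simp only [det2, h2, h3, h0, h1]
    ring
  have e1 : p - q = l • rotQ (a - b) := by
    rw [← neg_sub, h, ← smul_neg]
    congr 1
    ext i
    fin_cases i <;> simp [rotQ]
  unfold leftAngle EuclideanGeometry.angle
  rw [hdet, vsub_eq_sub, vsub_eq_sub, vsub_eq_sub, vsub_eq_sub, e1, h',
    ← angle_rotQ (a - b) (c - b)]
  rcases lt_or_gt_of_ne hl with hl | hl <;> rcases lt_or_gt_of_ne hm with hm | hm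
  · have := mul_pos_of_neg_of_neg hl hm
    rw [if_pos (by positivity), if_neg (by linarith),
      InnerProductGeometry.angle_smul_left_of_neg _ _ hl,
      InnerProductGeometry.angle_smul_right_of_neg _ _ hm, InnerProductGeometry.angle_neg_neg]
    ring
  · have := mul_neg_of_neg_of_pos hl hm
    rw [if_neg (by nlinarith), if_pos this,
      InnerProductGeometry.angle_smul_left_of_neg _ _ hl,
      InnerProductGeometry.angle_smul_right_of_pos _ _ hm, InnerProductGeometry.angle_neg_left]
    ring
  · have := mul_neg_of_pos_of_neg hl hm
    rw [if_neg (by nlinarith), if_pos this,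
      InnerProductGeometry.angle_smul_left_of_pos _ _ hl,
      InnerProductGeometry.angle_smul_right_of_neg _ _ hm, InnerProductGeometry.angle_neg_right]
    ring
  · have := mul_pos hl hm
    rw [if_pos (by positivity), if_neg (by linarith),
      InnerProductGeometry.angle_smul_left_of_pos _ _ hl,
      InnerProductGeometry.angle_smul_right_of_pos _ _ hm]
    ring

theorem det2_rot (a b c : Pt) : det2 a b c = det2 b c a := by
  unfold det2; ring

/-- Partial fan sum. -/
theorem fan_sum {P : ℕ → Pt} {N : ℕ}
    (h0 : ∀ j, 2 ≤ j → j ≤ N → 0 < det2 (P 0) (P 1) (P j))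
    (h1 : ∀ j, 1 ≤ j → j + 1 ≤ N → 0 < det2 (P j) (P (j + 1)) (P 0))
    (h2 : ∀ j, j + 2 ≤ N → 0 < det2 (P j) (P (j + 1)) (P (j + 2))) (m : ℕ) (hm : m + 2 ≤ N) :
    ∑ j ∈ Finset.range (m + 1), EuclideanGeometry.angle (P j) (P (j + 1)) (P (j + 2)) +
      EuclideanGeometry.angle (P 1) (P 0) (P (m + 2)) +
      EuclideanGeometry.angle (P (m + 1)) (P (m + 2)) (P 0) = (m + 1) * Real.pi := by
  have ne : ∀ {a b c : Pt}, 0 < det2 a b c → b ≠ a := by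
    rintro a b c h rfl
    simp [det2] at h
  induction m with
  | zero =>
    have := EuclideanGeometry.angle_add_angle_add_angle_eq_pi (P 2) (ne (h0 2 le_rfl hm))
    simp
    rw [EuclideanGeometry.angle_comm (P 1) (P 0)]
    linarith
  | succ m ih =>
    specialize ih (by omega)
    rw [Finset.sum_range_succ]
    have a1 := angle_add_of_det (h0 (m + 2) (by omega) (by omega))
      (by rw [det2_rot]; exact h1 (m + 2) (by omega) (by omega)) (h0 (m + 3) (by omega) (by omega))
    have a2 := angle_add_of_det (h1 (m + 2) (by omega) (by omega))
      (by rw [← det2_rot]; exact h1 (m + 1) (by omega) (by omega))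
      (by rw [← det2_rot]; exact h2 (m + 1) (by omega))
    have a3 := EuclideanGeometry.angle_add_angle_add_angle_eq_pi (P 0)
      (ne (h1 (m + 2) (by omega) (by omega)))
    have c3 := EuclideanGeometry.angle_comm (P (m+3)) (P (m+2)) (P (m+1))
    have c4 := EuclideanGeometry.angle_comm (P 0) (P (m+2)) (P (m+1))
    have c1 := EuclideanGeometry.angle_comm (P (m+3)) (P 0) (P (m+2))
    have c2 := EuclideanGeometry.angle_comm (P (m+3)) (P (m+2)) (P 0)
    push_cast
    simp only [add_assoc, Nat.reduceAdd] at *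
    linarith

theorem interior_sum (n : ℕ) [NeZero n] (hn : 5 ≤ n) (V : ZMod n → Pt) (hconv : ConvexCCW V) :
    ∑ i : ZMod n, EuclideanGeometry.angle (V (i - 1)) (V i) (V (i + 1)) = (n - 2) * Real.pi := by
  obtain ⟨k, rfl⟩ : ∃ k, n = k + 3 := ⟨n - 3, by omega⟩
  have hne : ∀ a b : ℕ, a < b → b < a + (k + 3) → ((b : ℕ) : ZMod (k + 3)) ≠ (a : ℕ) := by
    intro a b h h' he
    rw [ZMod.natCast_eq_natCast_iff] at he
    have := (Nat.modEq_iff_dvd' h.le).1 he.symm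
    have := Nat.le_of_dvd (by omega) this
    omega
  have key : ∀ i j : ℕ, (j < i ∨ i + 1 < j) → j < k + 3 → i < k + 3 → i + 1 < j + (k + 3) →
      0 < det2 (V (i : ℕ)) (V ((i + 1 : ℕ))) (V (j : ℕ)) := by
    intro i j h hj hi hij
    push_cast
    apply hconv.2
    · rcases h with h | h
      · exact (hne j i h (by omega)).symm
      · exact hne i j (by omega) (by omega)
    · have : ((i : ℕ) : ZMod (k + 3)) + 1 = ((i + 1 : ℕ) : ZMod (k + 3)) := by push_cast; rfl
      rw [this]
      rcases h with h | h
      · exact (hne j (i + 1) (by omega) (by omega)).symm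
      · exact hne (i + 1) j (by omega) (by omega)
  have main := fan_sum (P := fun j => V (j : ℕ)) (N := k + 2)
    (fun j hj hj' => key 0 j (by omega) (by omega) (by omega) (by omega))
    (fun j hj hj' => key j 0 (by omega) (by omega) (by omega) (by omega))
    (fun j hj => key j (j + 2) (by omega) (by omega) (by omega) (by omega)) k le_rfl
  have hs : ∑ i : ZMod (k + 3), EuclideanGeometry.angle (V (i - 1)) (V i) (V (i + 1)) =
      ∑ j ∈ Finset.range (k + 3), EuclideanGeometry.angle (V ((j : ZMod (k + 3)) - 1))
        (V (j : ZMod (k + 3))) (V ((j : ZMod (k + 3)) + 1)) := by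
    rw [Finset.sum_range]
    change ∑ i : Fin (k + 3), _ = _
    refine Finset.sum_congr rfl fun i _ => ?_
    have : ((i : ℕ) : ZMod (k + 3)) = i := ZMod.natCast_zmod_val (n := k + 3) i
    rw [this]
  have hz : ((k : ZMod (k + 3))) + 3 = 0 := by
    have := ZMod.natCast_self (k + 3)
    push_cast at this
    exact this
  rw [hs, Finset.sum_range_succ, Finset.sum_range_succ']
  have t1 : ((k + 2 : ℕ) : ZMod (k + 3)) - 1 = ((k + 1 : ℕ) : ZMod (k + 3)) := by push_cast; ring
  have t2 : ((k + 2 : ℕ) : ZMod (k + 3)) + 1 = ((0 : ℕ) : ZMod (k + 3)) := by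
    push_cast; rw [← hz]; ring
  have t3 : ((0 : ℕ) : ZMod (k + 3)) - 1 = ((k + 2 : ℕ) : ZMod (k + 3)) := by
    push_cast
    linear_combination -hz
  have t4 : ((0 : ℕ) : ZMod (k + 3)) + 1 = ((1 : ℕ) : ZMod (k + 3)) := by simp
  rw [t1, t2, t3, t4, EuclideanGeometry.angle_comm (V (k + 2 : ℕ)) (V (0 : ℕ))]
  have t5 : ∀ j : ℕ, EuclideanGeometry.angle (V (((j + 1 : ℕ) : ZMod (k + 3)) - 1))
      (V ((j + 1 : ℕ) : ZMod (k + 3))) (V (((j + 1 : ℕ) : ZMod (k + 3)) + 1)) =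
      EuclideanGeometry.angle (V (j : ℕ)) (V (j + 1 : ℕ)) (V (j + 2 : ℕ)) := by
    intro j
    congr 2 <;> push_cast <;> ring
  simp only [t5]
  rw [main]
  push_cast
  ring

theorem even_sign_changes (n : ℕ) [NeZero n] (l : ZMod n → ℝ) (hl : ∀ i, l i ≠ 0) :
    Even (Finset.univ.filter fun i : ZMod n => l (i - 1) * l i < 0).card := by
  have h1 : ∏ i : ZMod n, SignType.sign (l (i - 1) * l i) = 1 := by
    simp only [sign_mul, Finset.prod_mul_distrib]
    have : ∏ i : ZMod n, SignType.sign (l (i - 1)) = ∏ i : ZMod n, SignType.sign (l i) :=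
      Equiv.prod_comp (Equiv.subRight (1 : ZMod n)) (fun i => SignType.sign (l i))
    rw [this, ← Finset.prod_mul_distrib]
    refine Finset.prod_eq_one fun i _ => ?_
    rw [← sign_mul]
    exact sign_pos (mul_self_pos.2 (hl i))
  have h2 : ∀ i : ZMod n, SignType.sign (l (i - 1) * l i) =
      if l (i - 1) * l i < 0 then (-1 : SignType) else 1 := by
    intro i
    split_ifs with h
    · exact sign_neg h
    · exact sign_pos (lt_of_le_of_ne (not_lt.1 h) (mul_ne_zero (hl _) (hl _)).symm)
  simp only [h2] at h1
  rw [Finset.prod_ite, Finset.prod_const, Finset.prod_const_one, mul_one] at h1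
  by_contra h
  rw [Nat.not_even_iff_odd] at h
  rw [h.neg_one_pow] at h1
  exact absurd h1 (by decide)

/-- For a generic convex polygon `P` with `n ≥ 5` vertices with `N` locally extremal
vertices, the winding number of the evolute is `wind(E(P)) = (2 - N)/2`; consequently
`wind(E(P)) < 0` iff `P` has at least four locally extremal vertices. -/
theorem evolute_winding_number_formula
    (n : ℕ) [NeZero n] (hn : 5 ≤ n)
    (V O : ZMod n → Pt) (R : ZMod n → ℝ)
    (hconv : ConvexCCW V) (hgen : GenericPoly V) (hcirc : IsCircumData V O R) :
    wind O =
      (2 - ({i : ZMod n | LocMax V O R i ∨ LocMin V O R i}.ncard : ℝ)) / 2 ∧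
    (wind O < 0 ↔ 4 ≤ {i : ZMod n | LocMax V O R i ∨ LocMin V O R i}.ncard) := by
  have hne : ∀ a b : ℤ, a < b → b < a + n → ∀ i : ZMod n, i + (b : ZMod n) ≠ i + (a : ZMod n) := by
    intro a b h h' i he
    have he' : ((b : ℤ) : ZMod n) = (a : ℤ) := add_left_cancel he
    have hd := (ZMod.intCast_eq_intCast_iff_dvd_sub a b n).1 he'.symm
    have := Int.le_of_dvd (by omega) hd
    omega
  have n1 : ∀ i : ZMod n, i + 1 ≠ i := fun i => by simpa using hne 0 1 (by omega) (by omega) i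
  have n2 : ∀ i : ZMod n, i + 2 ≠ i := fun i => by simpa using hne 0 2 (by omega) (by omega) i
  have n3 : ∀ i : ZMod n, i + 2 ≠ i - 1 := fun i => by
    simpa [sub_eq_add_neg] using hne (-1) 2 (by omega) (by omega) i
  have n12 : ∀ i : ZMod n, i + 2 ≠ i + 1 := fun i => by
    simpa using hne 1 2 (by omega) (by omega) i
  have m1 : ∀ i : ZMod n, i - 1 ≠ i := fun i h => n1 (i - 1) (by rw [sub_add_cancel]; exact h.symm)
  have m2 : ∀ i : ZMod n, i - 1 ≠ i + 1 := fun i h => n2 (i - 1) (by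
    linear_combination -h)
  have hex : ∀ i, ∃ l : ℝ, O (i + 1) - O i = l • rotQ (V (i + 1) - V i) := by
    intro i
    apply exists_lam
    · exact fun h => n1 i (hconv.1 h).symm
    · rw [(hcirc i).2.1, (hcirc i).2.2]
    · have := hcirc (i + 1)
      rw [add_sub_cancel_right] at this
      rw [this.1, this.2.1]
  choose l hl using hex
  have hl' : ∀ i, O i - O (i - 1) = l (i - 1) • rotQ (V i - V (i - 1)) := by
    intro i
    have := hl (i - 1)
    rwa [sub_add_cancel] at this
  have hl0 : ∀ i, l i ≠ 0 := by
    intro i h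
    have h1 := hl i
    rw [h, zero_smul, sub_eq_zero] at h1
    have h2 := hcirc (i + 1)
    rw [h1, add_sub_cancel_right, add_assoc, one_add_one_eq_two] at h2
    have h3 := hcirc i
    refine hgen.2 (i - 1) i (i + 1) (i + 2) (m1 i) (m2 i) (n3 i).symm (n1 i).symm (n2 i).symm
      (n12 i).symm ⟨O i, R i, h3.1, h3.2.1, h3.2.2, ?_⟩
    rw [h2.2.2, ← h2.1, h3.2.1]
  have hdet : ∀ i, 0 < det2 (V (i - 1)) (V i) (V (i + 1)) := by
    intro i
    have := hconv.2 (i - 1) (i + 1) (m2 i).symm (by rw [sub_add_cancel]; exact n1 i)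
    rwa [sub_add_cancel] at this
  have hR : ∀ i, 0 ≤ R i := fun i => by rw [← (hcirc i).1]; exact dist_nonneg
  have pr : ∀ i, ∃ c : ℝ, 0 < c ∧ dist (V (i + 2)) (O i) ^ 2 - R i ^ 2 = l i * c := by
    intro i
    refine ⟨2 * det2 (V i) (V (i + 1)) (V (i + 2)),
      mul_pos two_pos (hconv.2 _ _ (n2 i) (n12 i)), ?_⟩
    have h := power_diff (hl i) (V (i + 2))
    have h2 := hcirc (i + 1)
    rw [add_sub_cancel_right, add_assoc, one_add_one_eq_two] at h2
    rw [h2.2.2, h2.1, (hcirc i).2.1] at h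
    linarith
  have pl : ∀ i, ∃ c : ℝ, 0 < c ∧ dist (V (i - 2)) (O i) ^ 2 - R i ^ 2 = - l (i - 1) * c := by
    intro i
    refine ⟨2 * det2 (V (i - 1)) (V i) (V (i - 2)), mul_pos two_pos ?_, ?_⟩
    · have := hconv.2 (i - 1) (i - 2) (fun h => n1 (i - 2) (by linear_combination -h))
        (fun h => n2 (i - 2) (by linear_combination -h))
      rwa [sub_add_cancel] at this
    have h := power_diff (hl' i) (V (i - 2))
    have h2 := hcirc (i - 1)
    rw [sub_add_cancel, sub_sub, one_add_one_eq_two] at h2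
    rw [h2.1, h2.2.1, (hcirc i).1] at h
    linarith
  have hiff : ∀ i, (LocMax V O R i ∨ LocMin V O R i) ↔ l (i - 1) * l i < 0 := by
    intro i
    obtain ⟨c, hc, h1⟩ := pr i
    obtain ⟨d, hd, h2⟩ := pl i
    have q1 : ∀ x : Pt, R i < dist x (O i) ↔ 0 < dist x (O i) ^ 2 - R i ^ 2 := by
      intro x
      rw [sub_pos]
      exact (sq_lt_sq₀ (hR i) dist_nonneg).symm
    have q2 : ∀ x : Pt, dist x (O i) < R i ↔ dist x (O i) ^ 2 - R i ^ 2 < 0 := by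
      intro x
      rw [sub_neg]
      exact (sq_lt_sq₀ dist_nonneg (hR i)).symm
    unfold LocMax LocMin
    rw [q1, q1, q2, q2, h1, h2, mul_pos_iff_of_pos_right hc, mul_pos_iff_of_pos_right hd,
      mul_neg_iff, mul_neg_iff, mul_neg_iff]
    have := hc.le.not_gt
    have := hd.le.not_gt
    simp only [neg_pos, neg_lt_zero]
    tauto
  have hset : {i : ZMod n | LocMax V O R i ∨ LocMin V O R i} =
      ((Finset.univ.filter fun i : ZMod n => l (i - 1) * l i < 0 : Finset (ZMod n)) :
        Set (ZMod n)) := by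
    ext i
    simp [hiff i]
  have heven := even_sign_changes n l hl0
  rw [hset, Set.ncard_coe_finset]
  have hw : wind O = (2 - ((Finset.univ.filter fun i : ZMod n => l (i - 1) * l i < 0).card : ℝ)) / 2 := by
    unfold wind
    have : ∀ i, leftAngle (O (i - 1)) (O i) (O (i + 1)) =
        EuclideanGeometry.angle (V (i - 1)) (V i) (V (i + 1)) +
          if l (i - 1) * l i < 0 then Real.pi else 0 :=
      fun i => turn (hl' i) (hl i) (hl0 _) (hl0 _) (hdet i)
    simp only [this]
    rw [Finset.sum_sub_distrib, Finset.sum_add_distrib, interior_sum n hn V hconv,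
      ← Finset.sum_filter, Finset.sum_const, Finset.sum_const, Finset.card_univ, ZMod.card]
    simp only [nsmul_eq_mul]
    have := Real.pi_ne_zero
    field_simp
    ring
  refine ⟨hw, ?_⟩
  rw [hw]
  generalize (Finset.univ.filter fun i : ZMod n => l (i - 1) * l i < 0).card = N at *
  obtain ⟨k, rfl⟩ := heven
  constructor
  · intro h
    have : (2 : ℝ) < ((k + k : ℕ) : ℝ) := by linarith
    have : 2 < k + k := by exact_mod_cast this
    omega
  · intro h
    have : (4 : ℝ) ≤ ((k + k : ℕ) : ℝ) := by exact_mod_cast h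
    linarith
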